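/- Let p > 2 be real and λ ≤ 0. Then there is no twice differentiable function u : [0,∞) → ℝ such that u(x) > 0 and u''(x) + u(x)^(p−1) = λ·u(x) for every x ≥ 0. -/

import Mathlib

open Real Set MeasureTheory Filter

/-- A function on `[0,∞)` whose derivative is at most `C` on `[a,∞)` grows there at most linearly
with slope `C`. -/
theorem sub_le_mul_sub_of_hasDerivWithinAt_Ici {f f' : ℝ → ℝ} {a C : ℝ} (ha : 0 ≤ a)
    (hf : ∀ x ∈ Ici (0 : ℝ), HasDerivWithinAt f (f' x) (Ici 0) x)
    (hC : ∀ x, a ≤ x → f' x ≤ C) {x : ℝ} (hx : a ≤ x) : f x - f a ≤ C * (x - a) := by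
  have hderiv : ∀ y ∈ interior (Ici a), HasDerivAt f (f' y) y := by
    intro y hy
    rw [interior_Ici] at hy
    have hy0 : 0 < y := ha.trans_lt hy
    exact (hf y hy0.le).hasDerivAt (Ici_mem_nhds hy0)
  refine (convex_Ici a).image_sub_le_mul_sub_of_deriv_le
    (fun y hy => ((hf y (ha.trans hy)).continuousWithinAt).mono (Ici_subset_Ici.2 ha))
    (fun y hy => (hderiv y hy).differentiableAt.differentiableWithinAt)
    (fun y hy => ?_) a self_mem_Ici x hx hx
  rw [(hderiv y hy).deriv]
  exact hC y (interior_subset hy)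

/-- A function on `[0,∞)` whose derivative is eventually bounded above by a negative constant takes
negative values. -/
theorem exists_neg_of_hasDerivWithinAt_Ici {f f' : ℝ → ℝ} {a C : ℝ} (ha : 0 ≤ a) (hC0 : C < 0)
    (hf : ∀ x ∈ Ici (0 : ℝ), HasDerivWithinAt f (f' x) (Ici 0) x)
    (hC : ∀ x, a ≤ x → f' x ≤ C) : ∃ x, 0 ≤ x ∧ f x < 0 := by
  have hpos : 0 ≤ (|f a| + 1) / -C := by
    have : 0 < -C := neg_pos.2 hC0
    positivity
  refine ⟨a + (|f a| + 1) / -C, by linarith, ?_⟩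
  have h := sub_le_mul_sub_of_hasDerivWithinAt_Ici ha hf hC (le_add_of_nonneg_right hpos)
  have hmul : C * (a + (|f a| + 1) / -C - a) = -(|f a| + 1) := by
    field_simp [hC0.ne]
    ring
  linarith [le_abs_self (f a)]

/-- Nonexistence of positive solutions of `u'' + u^(p-1) = λ u` on the half-line `[0,∞)`
when `λ ≤ 0`. -/
theorem stmt_10 (p lam : ℝ) (hp : 2 < p) (hlam : lam ≤ 0) :
    ¬ ∃ u u' u'' : ℝ → ℝ,
      (∀ x ∈ Ici (0 : ℝ), HasDerivWithinAt u (u' x) (Ici 0) x) ∧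
      (∀ x ∈ Ici (0 : ℝ), HasDerivWithinAt u' (u'' x) (Ici 0) x) ∧
      (∀ x ∈ Ici (0 : ℝ), 0 < u x) ∧
      (∀ x ∈ Ici (0 : ℝ), u'' x + u x ^ (p - 1) = lam * u x) := by
  rintro ⟨u, u', u'', hu, hu', hpos, heq⟩
  have hle : ∀ x, 0 ≤ x → u'' x ≤ -u x ^ (p - 1) := fun x hx => by
    linarith [heq x hx, mul_nonpos_of_nonpos_of_nonneg hlam (hpos x hx).le]
  have hnonneg : ∀ x, 0 ≤ x → 0 ≤ u' x := by
    intro a ha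
    by_contra! hneg
    obtain ⟨y, hy, huy⟩ := exists_neg_of_hasDerivWithinAt_Ici ha hneg hu fun x hx => by
      have := sub_le_mul_sub_of_hasDerivWithinAt_Ici (C := 0) ha hu'
        (fun y hy => (hle y (ha.trans hy)).trans
          (neg_nonpos.2 (rpow_nonneg (hpos y (ha.trans hy)).le _))) hx
      linarith
    exact (hpos y hy).not_gt huy
  have hmono : ∀ x, 0 ≤ x → u 0 ≤ u x := by
    intro x hx
    have := sub_le_mul_sub_of_hasDerivWithinAt_Ici (C := 0) le_rfl (fun y hy => (hu y hy).neg)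
      (fun y hy => neg_nonpos.2 (hnonneg y hy)) hx
    simp only [Pi.neg_apply] at this
    linarith
  have hu0 : 0 < u 0 := hpos 0 self_mem_Ici
  obtain ⟨y, hy, huy⟩ := exists_neg_of_hasDerivWithinAt_Ici le_rfl
    (neg_neg_of_pos (rpow_pos_of_pos hu0 (p - 1))) hu' fun x hx =>
      (hle x hx).trans
        (neg_le_neg (rpow_le_rpow hu0.le (hmono x hx) (by linarith)))
  exact (hnonneg y hy).not_gt huy
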